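/- Assume n ≥ 1 and let ρ: G → GL_d(ℂ) (d ≥ 1) be a representation. Over the field ℂ(q) of rational functions, let S(q) be the (n+1)×(n+1) Molien matrix with entries S(q)^i_j = (1/|G|) Σ_{k=0}^n |C_k|·χ_i(g_k)·conj(χ_j(g_k)) / det(1 − q·ρ(g_k)), and let C̃(q) be the n×n matrix with entries C̃(q)^i_j = (1/|G|) Σ_{k=0}^n |C_k|·χ_i(g_k)·conj(χ_j(g_k))·det(1 − q·ρ(g_k)) for 1 ≤ i, j ≤ n (the Euclidean graded Clebsch–Gordan matrix). Then C̃(q) is invertible over ℂ(q), S(q)^0_0 ≠ 0, and for all 1 ≤ i, j ≤ n, (C̃(q)^{-1})^i_j = ( S(q)^0_0·S(q)^i_j − S(q)^i_0·S(q)^0_j ) / S(q)^0_0. -/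

import Mathlib

open CategoryTheory
open scoped Classical

/-- The size of the conjugacy class of `x`. -/
noncomputable def classCard {G : Type*} [Group G] (x : G) : ℕ :=
  Nat.card {y : G // IsConj x y}

/-- `det(1 − q·ρ(g))` as an element of the field `ℂ(q)` of rational functions. -/
noncomputable def molienDetRat {G : Type} [Group G] {d : ℕ}
    (ρ : G →* Matrix.GeneralLinearGroup (Fin d) ℂ) (s : G) : RatFunc ℂ :=
  Matrix.det ((1 : Matrix (Fin d) (Fin d) (RatFunc ℂ)) -
    ((ρ s : Matrix (Fin d) (Fin d) ℂ)).map fun a => RatFunc.X * RatFunc.C a)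

open scoped Matrix ComplexOrder in
/-- A matrix representation `M` of a finite group satisfies `tr M(x⁻¹) = conj (tr M(x))`, because
the positive definite matrix `∑ h, (M h)ᴴ * M h` intertwines `M x⁻¹` with `(M x)ᴴ`. -/
theorem Matrix.trace_inv_eq_star_trace {G m : Type*} [Group G] [Fintype G] [Fintype m]
    [DecidableEq m] (M : G →* Matrix m m ℂ) (x : G) :
    (M x⁻¹).trace = star (M x).trace := by
  set P : Matrix m m ℂ := ∑ h, (M h)ᴴ * M h with hP
  have hpos : P.PosDef := by
    rw [hP, ← Finset.add_sum_erase _ _ (Finset.mem_univ (1 : G))]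
    refine Matrix.PosDef.add_posSemidef ?_
      (Matrix.posSemidef_sum _ fun h _ => Matrix.posSemidef_conjTranspose_mul_self _)
    simpa using Matrix.PosDef.one
  have hdet : IsUnit P.det := hpos.det_pos.ne'.isUnit
  have hcomm : P * M x⁻¹ = (M x)ᴴ * P := by
    rw [hP, Finset.sum_mul, Finset.mul_sum]
    refine (Fintype.sum_equiv (Equiv.mulRight x) _ _ fun h => ?_).symm
    simp only [Equiv.coe_mulRight, map_mul, Matrix.conjTranspose_mul, Matrix.mul_assoc]
    rw [← map_mul M x, mul_inv_cancel, map_one, Matrix.mul_one]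
  have h1 : M x⁻¹ = P⁻¹ * ((M x)ᴴ * P) := by
    rw [← hcomm, Matrix.nonsing_inv_mul_cancel_left _ _ hdet]
  rw [h1, Matrix.trace_mul_comm, Matrix.mul_assoc, Matrix.mul_nonsing_inv _ hdet,
    Matrix.mul_one, Matrix.trace_conjTranspose]

/-- Characters of a finite group satisfy `χ(x⁻¹) = conj χ(x)`. -/
theorem FDRep.character_inv_eq_conj {G : Type} [Group G] [Fintype G] (V : FDRep ℂ G) (x : G) :
    V.character x⁻¹ = (starRingEnd ℂ) (V.character x) := by
  let b := Module.finBasis ℂ V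
  let M : G →* Matrix _ _ ℂ := (LinearMap.toMatrixAlgEquiv b).toMulEquiv.toMonoidHom.comp V.ρ
  have hM : ∀ y, V.character y = (M y).trace := fun y =>
    LinearMap.trace_eq_matrix_trace ℂ b (V.ρ y)
  rw [hM, hM, Matrix.trace_inv_eq_star_trace]
  rfl

/-- A class function summed over the group is a weighted sum over class representatives. -/
theorem sum_classCard_mul {G ι : Type*} [Group G] [Fintype G] [Fintype ι] (g : ι → G)
    (hg : ∀ x : G, ∃! k, IsConj (g k) x) (f : G → ℂ)
    (hf : ∀ x y, IsConj x y → f x = f y) :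
    ∑ k, (classCard (g k) : ℂ) * f (g k) = ∑ x, f x := by
  choose cls hcls huniq using hg
  rw [← Finset.sum_fiberwise Finset.univ cls f]
  refine Finset.sum_congr rfl fun k _ => ?_
  have hmem : ∀ x, cls x = k ↔ IsConj (g k) x := fun x =>
    ⟨fun h => h ▸ hcls x, fun h => (huniq x k h).symm⟩
  rw [Finset.sum_congr rfl (g := fun _ => f (g k)) fun x hx =>
    (hf _ _ ((hmem x).1 (Finset.mem_filter.1 hx).2)).symm]
  rw [Finset.sum_const, nsmul_eq_mul, classCard, Nat.card_eq_fintype_card, Fintype.card_subtype]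
  simp only [hmem]

/-- First orthogonality relation, written as a sum over class representatives. -/
theorem FDRep.sum_classCard_character_mul_conj {G : Type} [Group G] [Fintype G] {ι : Type*}
    [Fintype ι] (g : ι → G) (hg : ∀ x : G, ∃! k, IsConj (g k) x) (V W : FDRep ℂ G)
    [Simple V] [Simple W] :
    (Fintype.card G : ℂ)⁻¹ * ∑ k, (classCard (g k) : ℂ) *
      (V.character (g k) * (starRingEnd ℂ) (W.character (g k))) =
      if Nonempty (V ≅ W) then 1 else 0 := by
  have : Invertible (Nat.card G : ℂ) := invertibleOfNonzero (by simp)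
  have hconj : ∀ (U : FDRep ℂ G) (x y : G), IsConj x y → U.character x = U.character y := by
    intro U x y hxy
    obtain ⟨c, rfl⟩ := isConj_iff.1 hxy
    exact (U.char_conj x c).symm
  rw [sum_classCard_mul g hg (fun x => V.character x * (starRingEnd ℂ) (W.character x))
    (fun x y h => by simp only [hconj _ _ _ h])]
  have := FDRep.char_orthonormal V W
  simpa only [Nat.card_eq_fintype_card, FDRep.character_inv_eq_conj] using this

/-- The polynomial `det(1 − q·ρ(g))`. -/
noncomputable def molienDetPoly {G : Type} [Group G] {d : ℕ}
    (ρ : G →* Matrix.GeneralLinearGroup (Fin d) ℂ) (s : G) : Polynomial ℂ :=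
  Matrix.det ((1 : Matrix (Fin d) (Fin d) (Polynomial ℂ)) -
    ((ρ s : Matrix (Fin d) (Fin d) ℂ)).map fun a => Polynomial.X * Polynomial.C a)

theorem algebraMap_molienDetPoly {G : Type} [Group G] {d : ℕ}
    (ρ : G →* Matrix.GeneralLinearGroup (Fin d) ℂ) (s : G) :
    algebraMap (Polynomial ℂ) (RatFunc ℂ) (molienDetPoly ρ s) = molienDetRat ρ s := by
  rw [molienDetPoly, molienDetRat, RingHom.map_det]
  congr 1
  ext i j
  simp [Matrix.one_apply, apply_ite (algebraMap (Polynomial ℂ) (RatFunc ℂ))]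
  exact mul_comm _ _

theorem eval_zero_molienDetPoly {G : Type} [Group G] {d : ℕ}
    (ρ : G →* Matrix.GeneralLinearGroup (Fin d) ℂ) (s : G) :
    (molienDetPoly ρ s).eval 0 = 1 := by
  rw [molienDetPoly, ← Polynomial.coe_evalRingHom, RingHom.map_det]
  convert Matrix.det_one (n := Fin d) (R := ℂ)
  ext i j
  simp [Matrix.one_apply, apply_ite (Polynomial.eval (0 : ℂ))]

theorem molienDetRat_ne_zero {G : Type} [Group G] {d : ℕ}
    (ρ : G →* Matrix.GeneralLinearGroup (Fin d) ℂ) (s : G) : molienDetRat ρ s ≠ 0 := by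
  rw [← algebraMap_molienDetPoly]
  refine RatFunc.algebraMap_ne_zero fun h => ?_
  simpa [h] using eval_zero_molienDetPoly ρ s

/-- A sum of fractions `c k / P k`, whose denominators take the value `1` at `0`, can vanish only
if the coefficients sum to zero. -/
theorem sum_eq_zero_of_sum_div_eq_zero {ι : Type*} [Fintype ι] (c : ι → ℕ)
    (P : ι → Polynomial ℂ) (hP : ∀ k, (P k).eval 0 = 1)
    (h : ∑ k, (c k : RatFunc ℂ) / algebraMap (Polynomial ℂ) (RatFunc ℂ) (P k) = 0) :
    ∑ k, c k = 0 := by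
  have hne : ∀ k, algebraMap (Polynomial ℂ) (RatFunc ℂ) (P k) ≠ 0 := fun k =>
    RatFunc.algebraMap_ne_zero fun h => by simpa [h] using hP k
  have h2 : ∑ k, (c k : Polynomial ℂ) * ∏ l ∈ Finset.univ.erase k, P l = 0 := by
    apply RatFunc.algebraMap_injective ℂ
    rw [map_zero, map_sum, ← zero_mul (∏ l, algebraMap (Polynomial ℂ) (RatFunc ℂ) (P l)), ← h,
      Finset.sum_mul]
    refine Finset.sum_congr rfl fun k _ => ?_
    rw [← Finset.mul_prod_erase _ _ (Finset.mem_univ k), map_mul, map_natCast, map_prod,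
      ← mul_assoc, div_mul_cancel₀ _ (hne k)]
  have h3 := congrArg (Polynomial.eval 0) h2
  simp only [Polynomial.eval_finsetSum, Polynomial.eval_mul, Polynomial.eval_natCast,
    Polynomial.eval_prod, hP, Finset.prod_const_one, mul_one, Polynomial.eval_zero] at h3
  exact_mod_cast h3

/-- The inverse of a principal submatrix, as a Schur complement in the inverse matrix. -/
theorem Matrix.submatrix_succ_mul_schur_eq_one {K : Type*} [Field K] {n : ℕ}
    (C S : Matrix (Fin (n + 1)) (Fin (n + 1)) K) (hCS : C * S = 1) (h0 : S 0 0 ≠ 0) :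
    (Matrix.of fun i j : Fin n => C i.succ j.succ) *
      (Matrix.of fun i j : Fin n =>
        (S 0 0 * S i.succ j.succ - S i.succ 0 * S 0 j.succ) / S 0 0) = 1 := by
  ext i j
  have h1 := congrFun (congrFun hCS i.succ) j.succ
  have h2 := congrFun (congrFun hCS i.succ) 0
  rw [Matrix.mul_apply, Fin.sum_univ_succ] at h1 h2
  rw [Matrix.one_apply_ne (Fin.succ_ne_zero i)] at h2
  have h3 : (1 : Matrix (Fin (n + 1)) (Fin (n + 1)) K) i.succ j.succ =
      (1 : Matrix (Fin n) (Fin n) K) i j := by simp [Matrix.one_apply]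
  rw [h3] at h1
  rw [Matrix.mul_apply, ← h1]
  simp only [Matrix.of_apply]
  have h4 : ∀ k : Fin n, C i.succ k.succ *
      ((S 0 0 * S k.succ j.succ - S k.succ 0 * S 0 j.succ) / S 0 0) =
      C i.succ k.succ * S k.succ j.succ -
        C i.succ k.succ * S k.succ 0 * (S 0 j.succ / S 0 0) := fun k => by field_simp
  rw [Finset.sum_congr rfl fun k _ => h4 k, Finset.sum_sub_distrib, ← Finset.sum_mul,
    eq_neg_of_add_eq_zero_right h2]
  field_simp
  ring

theorem stmt15 {G : Type} [Group G] [Fintype G] {n : ℕ} (hn : 1 ≤ n)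
    (g : Fin (n + 1) → G) (hg1 : g 0 = 1)
    (hg : ∀ x : G, ∃! k : Fin (n + 1), IsConj (g k) x)
    (R : Fin (n + 1) → FDRep ℂ G)
    (hsimple : ∀ i, Simple (R i))
    (htriv : ∀ x : G, (R 0).character x = 1)
    (hdist : ∀ i j, i ≠ j → ¬ Nonempty (R i ≅ R j))
    {d : ℕ} (hd : 1 ≤ d) (ρ : G →* Matrix.GeneralLinearGroup (Fin d) ℂ)
    -- `S` : the Molien matrix of `ρ` over `ℂ(q)`
    (S : Fin (n + 1) → Fin (n + 1) → RatFunc ℂ)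
    (hS : ∀ i j, S i j =
      RatFunc.C ((Fintype.card G : ℂ)⁻¹) *
        ∑ k : Fin (n + 1), (classCard (g k) : RatFunc ℂ) *
          RatFunc.C ((R i).character (g k)) *
          RatFunc.C ((starRingEnd ℂ) ((R j).character (g k))) / molienDetRat ρ (g k))
    -- `Ct` : the Euclidean graded Clebsch–Gordan matrix of `ρ`
    (Ct : Matrix (Fin n) (Fin n) (RatFunc ℂ))
    (hCt : ∀ i j : Fin n, Ct i j =
      RatFunc.C ((Fintype.card G : ℂ)⁻¹) *
        ∑ k : Fin (n + 1), (classCard (g k) : RatFunc ℂ) *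
          RatFunc.C ((R i.succ).character (g k)) *
          RatFunc.C ((starRingEnd ℂ) ((R j.succ).character (g k))) * molienDetRat ρ (g k))
    -- `A` : the claimed inverse of `Ct`
    (A : Matrix (Fin n) (Fin n) (RatFunc ℂ))
    (hA : ∀ i j : Fin n, A i j =
      (S 0 0 * S i.succ j.succ - S i.succ 0 * S 0 j.succ) / S 0 0) :
    S 0 0 ≠ 0 ∧ Ct * A = 1 ∧ A * Ct = 1 := by
  have hSne : S 0 0 ≠ 0 := by
    rw [hS]
    refine mul_ne_zero (by simp) fun h => ?_
    have h2 := sum_eq_zero_of_sum_div_eq_zero (fun k => classCard (g k))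
      (fun k => molienDetPoly ρ (g k)) (fun k => eval_zero_molienDetPoly ρ (g k))
      (by simpa [htriv, algebraMap_molienDetPoly] using h)
    have h3 : classCard (g 0) = 0 := by
      simpa using (Finset.sum_eq_zero_iff.1 h2) 0 (Finset.mem_univ _)
    have : Nonempty {y : G // IsConj (g 0) y} := ⟨⟨g 0, IsConj.refl _⟩⟩
    exact Nat.card_pos.ne' h3
  let X : Matrix (Fin (n + 1)) (Fin (n + 1)) (RatFunc ℂ) :=
    Matrix.of fun i k => RatFunc.C ((R i).character (g k))
  let Y : Matrix (Fin (n + 1)) (Fin (n + 1)) (RatFunc ℂ) :=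
    Matrix.of fun k j => RatFunc.C ((Fintype.card G : ℂ)⁻¹) * (classCard (g k) : RatFunc ℂ) *
      RatFunc.C ((starRingEnd ℂ) ((R j).character (g k)))
  let D : Fin (n + 1) → RatFunc ℂ := fun k => molienDetRat ρ (g k)
  have hXY : X * Y = 1 := by
    ext i j
    have := hsimple i
    have := hsimple j
    have horth := congrArg (RatFunc.C (K := ℂ))
      (FDRep.sum_classCard_character_mul_conj g hg (R i) (R j))
    have hiff : Nonempty (R i ≅ R j) ↔ i = j :=
      ⟨fun h => by_contra fun hne => hdist i j hne h, fun h => h ▸ ⟨Iso.refl _⟩⟩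
    simp only [hiff, apply_ite (RatFunc.C (K := ℂ)), map_one, map_zero] at horth
    rw [Matrix.one_apply, ← horth, Matrix.mul_apply, map_mul, map_sum, Finset.mul_sum]
    refine Finset.sum_congr rfl fun k _ => ?_
    simp only [X, Y, Matrix.of_apply, map_mul, map_natCast]
    ring
  have hYX : Y * X = 1 := mul_eq_one_comm.1 hXY
  have hDD : Matrix.diagonal D * Matrix.diagonal (fun k => (D k)⁻¹) = 1 := by
    rw [Matrix.diagonal_mul_diagonal, ← Matrix.diagonal_one]
    congr 1
    ext k
    exact mul_inv_cancel₀ (molienDetRat_ne_zero ρ (g k))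
  have hCS : (X * Matrix.diagonal D * Y) * Matrix.of S = 1 := by
    have hSeq : Matrix.of S = X * Matrix.diagonal (fun k => (D k)⁻¹) * Y := by
      ext i j
      rw [Matrix.of_apply, hS, Matrix.mul_apply, Finset.mul_sum]
      refine Finset.sum_congr rfl fun k _ => ?_
      simp only [Matrix.mul_diagonal, X, Y, D, Matrix.of_apply]
      ring
    calc (X * Matrix.diagonal D * Y) * Matrix.of S
        = X * (Matrix.diagonal D * ((Y * X) * Matrix.diagonal (fun k => (D k)⁻¹))) * Y := by
          rw [hSeq]; simp only [Matrix.mul_assoc]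
      _ = 1 := by rw [hYX, Matrix.one_mul, hDD, Matrix.mul_one, hXY]
  have hCA : Ct * A = 1 := by
    rw [← Matrix.submatrix_succ_mul_schur_eq_one _ (Matrix.of S) hCS hSne]
    congr 1
    · ext i j
      rw [hCt, Matrix.of_apply, Matrix.mul_apply, Finset.mul_sum]
      refine Finset.sum_congr rfl fun k _ => ?_
      simp only [Matrix.mul_diagonal, X, Y, D, Matrix.of_apply]
      ring
    · ext i j
      exact hA i j
  exact ⟨hSne, hCA, mul_eq_one_comm.1 hCA⟩
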